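/- arXiv:2508.05051 — 2 statements merged into one kernel-verified Lean document; each statement's English description precedes it below -/
import Mathlib

section
/- Let (R, m, k) be a Noetherian local ring and M a finitely generated nonzero R-module with t = depth M. Then Ext^t_R(k, M) is isomorphic to Hom_R(k, H^t_m(M)), and in particular H^t_m(M) ≠ 0. -/
open CategoryTheory CategoryTheory.Limits

universe u

variable (R : Type u) [CommRing R]

/-- `Ext^n_R(A, B)` as an `R`-module (object of `ModuleCat R`). -/
noncomputable def extMod (n : ℕ) (A B : ModuleCat.{u} R) : ModuleCat.{u} R :=
  ((Ext R (ModuleCat.{u} R) n).obj (Opposite.op A)).obj B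

/-- The depth of a module over a local ring:
`depth M = min { i | Ext^i_R(k, M) ≠ 0 }`. -/
noncomputable def moduleDepth [IsLocalRing R] (M : ModuleCat.{u} R) : ℕ :=
  sInf {i : ℕ |
    ¬ IsZero (extMod R i (ModuleCat.of R (R ⧸ IsLocalRing.maximalIdeal R)) M)}

section

open IsLocalRing

variable {R}

lemma Module.support_subset_zeroLocus_of_pow_smul_eq_zero {I : Ideal R} {N : Type*}
    [AddCommGroup N] [Module R N] [Module.Finite R N] {n : ℕ}
    (h : ∀ a ∈ I ^ n, ∀ x : N, a • x = 0) :
    Module.support R N ⊆ PrimeSpectrum.zeroLocus I := by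
  rw [Module.support_eq_zeroLocus, PrimeSpectrum.zeroLocus_subset_zeroLocus_iff]
  intro a ha
  exact ⟨n, Module.mem_annihilator.mpr (h _ (Ideal.pow_mem_pow ha n))⟩

lemma maximalIdeal_smul_top_lt (R M : Type*) [CommRing R] [IsLocalRing R] [AddCommGroup M]
    [Module R M] [Module.Finite R M] [Nontrivial M] :
    maximalIdeal R • (⊤ : Submodule R M) < ⊤ :=
  lt_top_iff_ne_top.mpr (Submodule.top_ne_ideal_smul_of_le_jacobson_annihilator
    (maximalIdeal_le_jacobson _)).symm

/-- A nonzero finitely generated module over a Noetherian local ring has finite depth. -/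
lemma exists_not_subsingleton_ext_residueField [IsNoetherianRing R] [IsLocalRing R]
    (M : ModuleCat.{u} R) [Module.Finite R M] [Nontrivial M] :
    ∃ i, ¬ Subsingleton (Abelian.Ext (ModuleCat.of R (R ⧸ maximalIdeal R)) M i) := by
  by_contra! h
  obtain ⟨d, hd⟩ : ∃ d : ℕ, ringKrullDim R < d := by
    refine ⟨(LTSeries.longestOf (PrimeSpectrum R)).length + 1, ?_⟩
    rw [ringKrullDim, Order.krullDim_eq_length_of_finiteDimensionalOrder]
    exact_mod_cast Nat.lt_succ_self _
  obtain ⟨rs, hlen, -, hreg⟩ := ModuleCat.exists_isRegular_of_exists_subsingleton_ext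
    (maximalIdeal R) d M (maximalIdeal_smul_top_lt R M) (ModuleCat.of R (R ⧸ maximalIdeal R))
    (by rw [Module.support_eq_zeroLocus, Ideal.annihilator_quotient]) (fun i _ ↦ h i)
  have hsum := Module.supportDim_add_length_eq_supportDim_of_isRegular rs hreg
  have hne : Nontrivial (M ⧸ Ideal.ofList rs • (⊤ : Submodule R M)) :=
    Submodule.Quotient.nontrivial_iff.mpr hreg.top_ne_smul.symm
  have hnonneg : (0 : WithBot ℕ∞) ≤
      Module.supportDim R (M ⧸ Ideal.ofList rs • (⊤ : Submodule R M)) :=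
    have := (Module.nonempty_support_of_nontrivial (R := R)
      (M := M ⧸ Ideal.ofList rs • (⊤ : Submodule R M))).to_subtype
    Order.krullDim_nonneg
  refine hd.not_ge (le_trans ?_ (Module.supportDim_le_ringKrullDim R M))
  rw [← hsum, hlen]
  exact le_add_of_nonneg_left hnonneg

namespace ModuleCat

/-- The short complex `0 ⟶ ker f ⟶ A ⟶ B ⟶ 0` given by a linear map `f`. -/
abbrev kerShortComplex {A B : ModuleCat.{u} R} (f : A ⟶ B) : ShortComplex (ModuleCat.{u} R) :=
  ShortComplex.mk (ModuleCat.ofHom (LinearMap.ker f.hom).subtype) f (by ext x; exact x.2)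

lemma kerShortComplex_shortExact {A B : ModuleCat.{u} R} (f : A ⟶ B)
    (hf : Function.Surjective f) : (kerShortComplex f).ShortExact where
  exact := by
    rw [ShortComplex.ShortExact.moduleCat_exact_iff_function_exact]
    exact LinearMap.exact_subtype_ker_map f.hom
  mono_f := (ModuleCat.mono_iff_injective _).mpr (Submodule.subtype_injective _)
  epi_g := (ModuleCat.epi_iff_surjective _).mpr hf

/-- If `Ext^i(N, M)` vanishes for `i < t` and all finitely generated `I`-power torsion `N`, then
`Ext^t(-, M)` sends surjections of such modules to injections. -/
lemma mk₀_comp_injective_of_surjective [IsNoetherianRing R] {I : Ideal R} {M : ModuleCat.{u} R}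
    {t n : ℕ}
    (hM : ∀ N : ModuleCat.{u} R, Module.Finite R N → (∀ a ∈ I ^ n, ∀ x : N, a • x = 0) →
      ∀ i < t, Subsingleton (Abelian.Ext N M i))
    {A B : ModuleCat.{u} R} [Module.Finite R A] (hA : ∀ a ∈ I ^ n, ∀ x : A, a • x = 0)
    (f : A ⟶ B) (hf : Function.Surjective f) :
    Function.Injective
      (fun α : Abelian.Ext B M t ↦ (Abelian.Ext.mk₀ f).comp α (zero_add t)) := by
  cases t with
  | zero =>
    have : Epi f := (ModuleCat.epi_iff_surjective _).mpr hf
    exact Abelian.Ext.precomp_mk₀_injective_of_epi M f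
  | succ t =>
    have hinj : Function.Injective ((Abelian.Ext.mk₀ f).precomp M (zero_add (t + 1))) := by
      rw [injective_iff_map_eq_zero]
      intro α hα
      obtain ⟨β, rfl⟩ := Abelian.Ext.contravariant_sequence_exact₃
        (kerShortComplex_shortExact f hf) M α hα (add_comm 1 t)
      have := hM (ModuleCat.of R (LinearMap.ker f.hom)) inferInstance
        (fun a ha x ↦ Subtype.ext (hA a ha x)) t t.lt_succ_self
      rw [Subsingleton.elim β 0, Abelian.Ext.comp_zero]
    exact hinj

/-- If `Ext^i(N, M)` vanishes for `i < t` and all finitely generated `I`-power torsion `N`, then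
`Ext^t(-, M)` is left exact on such modules. -/
lemma exists_mk₀_comp_eq_of_exact [IsNoetherianRing R] {I : Ideal R} {M : ModuleCat.{u} R}
    {t n : ℕ}
    (hM : ∀ N : ModuleCat.{u} R, Module.Finite R N → (∀ a ∈ I ^ n, ∀ x : N, a • x = 0) →
      ∀ i < t, Subsingleton (Abelian.Ext N M i))
    {C A B : ModuleCat.{u} R} [Module.Finite R C] (hC : ∀ a ∈ I ^ n, ∀ x : C, a • x = 0)
    (g : C ⟶ A) (f : A ⟶ B) (hgf : Function.Exact g f) (hf : Function.Surjective f)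
    (α : Abelian.Ext A M t) (hα : (Abelian.Ext.mk₀ g).comp α (zero_add t) = 0) :
    ∃ β : Abelian.Ext B M t, (Abelian.Ext.mk₀ f).comp β (zero_add t) = α := by
  refine Abelian.Ext.contravariant_sequence_exact₂ (kerShortComplex_shortExact f hf) M α ?_
  let p : C ⟶ ModuleCat.of R (LinearMap.ker f.hom) :=
    ModuleCat.ofHom (g.hom.codRestrict _ fun x ↦ hgf.apply_apply_eq_zero x)
  have hp : Function.Surjective p := by
    rintro ⟨x, hx⟩
    obtain ⟨y, rfl⟩ := (hgf x).mp hx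
    exact ⟨y, rfl⟩
  refine mk₀_comp_injective_of_surjective hM hC p hp ?_
  simp only [Abelian.Ext.mk₀_comp_mk₀_assoc, Abelian.Ext.comp_zero]
  exact hα

/-- If `Ext^i(N, M)` vanishes for `i < t` and all finitely generated `I`-power torsion `N`, then
for such `A` every `α : Ext^t(A, M)` killed by `I` comes from `Ext^t(B, M)` where `B = A / I A`. -/
lemma exists_mk₀_comp_eq_of_smul_eq_zero [IsNoetherianRing R] {I : Ideal R} {M : ModuleCat.{u} R}
    {t n : ℕ}
    (hM : ∀ N : ModuleCat.{u} R, Module.Finite R N → (∀ a ∈ I ^ n, ∀ x : N, a • x = 0) →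
      ∀ i < t, Subsingleton (Abelian.Ext N M i))
    {A B : ModuleCat.{u} R} [Module.Finite R A] (hA : ∀ a ∈ I ^ n, ∀ x : A, a • x = 0)
    (f : A ⟶ B) (hf : Function.Surjective f)
    (hker : LinearMap.ker f.hom = I • (⊤ : Submodule R A))
    (α : Abelian.Ext A M t) (hα : ∀ a ∈ I, a • α = 0) :
    ∃ β : Abelian.Ext B M t, (Abelian.Ext.mk₀ f).comp β (zero_add t) = α := by
  obtain ⟨s, rfl⟩ := IsNoetherian.noetherian I
  let g : ModuleCat.of R (s → A) ⟶ A :=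
    ∑ a : s, (a : R) • ModuleCat.ofHom (LinearMap.proj a : (s → A) →ₗ[R] A)
  have hg (x : s → A) : g x = ∑ a : s, (a : R) • x a := by
    simp [g, ModuleCat.hom_sum]
  refine exists_mk₀_comp_eq_of_exact hM (C := ModuleCat.of R (s → A))
    (fun a ha x ↦ funext fun b ↦ hA a ha (x b)) g f (fun x ↦ ?_) hf α ?_
  · have hrange : LinearMap.ker f.hom = LinearMap.range g.hom := by
      rw [hker]
      apply le_antisymm
      · rw [Submodule.smul_le]
        intro r hr y _
        obtain ⟨c, rfl⟩ := Submodule.mem_span_finset'.mp hr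
        refine ⟨fun a ↦ c a • y, (hg _).trans ?_⟩
        simp only [Finset.sum_smul, smul_smul, smul_eq_mul, mul_comm]
      · rintro _ ⟨y, rfl⟩
        refine (hg y).symm ▸ sum_mem fun a _ ↦ ?_
        exact Submodule.smul_mem_smul (Submodule.subset_span a.2) trivial
    exact SetLike.ext_iff.mp hrange x
  · have hsum (σ : Finset s) : (Abelian.Ext.mk₀ (∑ a ∈ σ, (a : R) • ModuleCat.ofHom
        (LinearMap.proj a : (s → A) →ₗ[R] A))).comp α (zero_add t) = 0 := by
      classical
      induction σ using Finset.induction_on with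
      | empty => simp
      | insert a σ ha ih =>
        rw [Finset.sum_insert ha, Abelian.Ext.mk₀_add, Abelian.Ext.add_comp, ih, add_zero,
          Abelian.Ext.mk₀_smul, Abelian.Ext.smul_comp, ← Abelian.Ext.comp_smul,
          hα a (Submodule.subset_span a.2), Abelian.Ext.comp_zero]
    exact hsum Finset.univ

end ModuleCat

end

section

open Opposite CochainComplex HomComplex

namespace CategoryTheory.ProjectiveResolution

universe w v v'

variable {R : Type v'} [CommRing R] {C : Type u} [Category.{v} C] [Abelian C] [Linear R C]
  {X Y : C} (P : ProjectiveResolution X) (n : ℕ)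

variable (R Y) in
/-- The complex in `(ModuleCat R)ᵒᵖ` obtained by applying `Hom(-, Y)` to a projective
resolution. -/
noncomputable abbrev homComplex : ChainComplex (ModuleCat.{v} R)ᵒᵖ ℕ :=
  (((linearYoneda R C).obj Y).rightOp.mapHomologicalComplex _).obj P.complex

variable (R Y) in
/-- The inclusion of the `n`-cocycles of `Hom(P, Y)` into `Hom(Pₙ, Y)`. -/
noncomputable def cocycleHom : ((P.homComplex R Y).opcycles n).unop →ₗ[R] (P.complex.X n ⟶ Y) :=
  ((P.homComplex R Y).pOpcycles n).unop.hom

lemma cocycleHom_injective : Function.Injective (P.cocycleHom R Y n) :=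
  (ModuleCat.mono_iff_injective ((P.homComplex R Y).pOpcycles n).unop).mp inferInstance

lemma d_comp_cocycleHom (m : ℕ) (c) : P.complex.d m n ≫ P.cocycleHom R Y n c = 0 := by
  have h := congr_arg Quiver.Hom.unop ((P.homComplex R Y).d_pOpcycles m n)
  exact ConcreteCategory.congr_hom h c

lemma exists_cocycleHom_eq (f : P.complex.X n ⟶ Y) (hf : P.complex.d (n + 1) n ≫ f = 0) :
    ∃ c, P.cocycleHom R Y n c = f := by
  have h := (ShortComplex.exact_of_g_is_cokernel
    (ShortComplex.mk _ _ ((P.homComplex R Y).d_pOpcycles (n + 1) n))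
    ((P.homComplex R Y).opcyclesIsCokernel (n + 1) n (by simp))).unop
  rw [ShortComplex.moduleCat_exact_iff] at h
  exact h f hf

lemma extMk_eq_zero_iff_of_next [HasExt.{w} C] (f : P.complex.X n ⟶ Y)
    (hf : P.complex.d (n + 1) n ≫ f = 0)
    (p : ℕ) (hp : (ComplexShape.down ℕ).next n = p) :
    P.extMk f (n + 1) rfl hf = 0 ↔ ∃ g : P.complex.X p ⟶ Y, P.complex.d n p ≫ g = f := by
  subst hp
  cases n with
  | succ n =>
    rw [P.extMk_eq_zero_iff f _ rfl hf n rfl, ChainComplex.next_nat_succ]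
  | zero =>
    rw [← P.extEquivCohomologyClass.apply_eq_iff_eq, extEquivCohomologyClass_extMk,
      extEquivCohomologyClass_zero, CohomologyClass.mk_eq_zero_iff,
      Cocycle.toSingleMk_mem_coboundaries_iff _ _ _ _ _ 1 (by lia)]
    have h₀ : P.cochainComplex.d (-((0 : ℕ) : ℤ)) 1 = 0 :=
      (isZero_of_isStrictlyLE P.cochainComplex 0 1 (by lia)).eq_of_tgt _ _
    have h₁ : P.complex.d 0 ((ComplexShape.down ℕ).next 0) = 0 :=
      P.complex.shape _ _ (by simp)
    rw [h₀, h₁]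
    simp only [zero_comp]
    refine ⟨fun ⟨_, h⟩ ↦ ⟨0, ?_⟩, fun ⟨_, h⟩ ↦ ⟨0, by rw [← h, comp_zero]⟩⟩
    rw [← cancel_epi (P.cochainComplexXIso (-((0 : ℕ) : ℤ)) 0 rfl).hom, comp_zero]
    exact h

variable [EnoughProjectives C]

variable (R Y) in
/-- The value of the left derived functor `Ext^n(-, Y)` as the homology of `Hom(P, Y)`. -/
noncomputable def isoHomology :
    ((((linearYoneda R C).obj Y).rightOp).leftDerived n).obj X ≅ (P.homComplex R Y).homology n :=
  P.isoLeftDerivedObj ((linearYoneda R C).obj Y).rightOp n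

/-- The class in `Ext^n(X, Y)`, defined as a left derived functor, of an `n`-cocycle. -/
noncomputable def cocycleClass : ((P.homComplex R Y).opcycles n).unop →ₗ[R]
    ((Ext R C n).obj (op X)).obj Y :=
  ((P.isoHomology R Y n).hom ≫
    (P.homComplex R Y).homologyι n).unop.hom

lemma cocycleClass_surjective :
    Function.Surjective (P.cocycleClass (R := R) (Y := Y) n) :=
  (ModuleCat.epi_iff_surjective
    ((P.isoHomology R Y n).hom ≫
      (P.homComplex R Y).homologyι n).unop).mp inferInstance

lemma cocycleClass_eq_zero_iff (p : ℕ) (hp : (ComplexShape.down ℕ).next n = p) (c) :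
    P.cocycleClass n c = 0 ↔
      ∃ g : P.complex.X p ⟶ Y, P.complex.d n p ≫ g = P.cocycleHom R Y n c := by
  have h := (ShortComplex.exact_of_f_is_kernel
    (ShortComplex.mk _ _ ((P.homComplex R Y).homologyι_comp_fromOpcycles n p))
    ((P.homComplex R Y).homologyIsKernel n p hp)).unop
  rw [ShortComplex.ShortExact.moduleCat_exact_iff_function_exact] at h
  have hι : P.cocycleClass n c = 0 ↔ ((P.homComplex R Y).homologyι n).unop c = 0 := by
    have : Function.Injective
      (P.isoHomology R Y n).hom.unop :=
      (ModuleCat.mono_iff_injective _).mp inferInstance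
    exact map_eq_zero_iff (P.isoHomology R Y n).hom.unop.hom
      this
  have hd (g : P.complex.X p ⟶ Y) :
      P.cocycleHom R Y n (((P.homComplex R Y).fromOpcycles n p).unop g) =
        P.complex.d n p ≫ g :=
    ConcreteCategory.congr_hom
      (congr_arg Quiver.Hom.unop ((P.homComplex R Y).p_fromOpcycles n p)) g
  exact hι.trans ((h c).trans (exists_congr fun g ↦
    (P.cocycleHom_injective n).eq_iff.symm.trans (Eq.congr_left (hd g))))

lemma cocycleClass_naturality {X' : C} {P' : ProjectiveResolution X'} {f : X ⟶ X'}
    (φ : Hom P P' f) (c) (c') (hc : P.cocycleHom R Y n c = φ.hom.f n ≫ P'.cocycleHom R Y n c') :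
    P.cocycleClass n c = ((Ext R C n).map f.op).app Y (P'.cocycleClass n c') := by
  let F := ((linearYoneda R C).obj Y).rightOp
  have h₁ : (F.leftDerived n).map f ≫ (P'.isoHomology R Y n).hom =
      (P.isoHomology R Y n).hom ≫
        HomologicalComplex.homologyMap
          ((F.mapHomologicalComplex (ComplexShape.down ℕ)).map φ.hom) n :=
    isoLeftDerivedObj_hom_naturality f P P' φ.hom
      (φ.hom_f_zero_comp_π_f_zero.trans (by simp)) F n
  have h₂ := HomologicalComplex.homologyι_naturality
    ((F.mapHomologicalComplex (ComplexShape.down ℕ)).map φ.hom) n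
  have h₃ := HomologicalComplex.p_opcyclesMap
    ((F.mapHomologicalComplex (ComplexShape.down ℕ)).map φ.hom) n
  have hc' : c = (HomologicalComplex.opcyclesMap
      ((F.mapHomologicalComplex (ComplexShape.down ℕ)).map φ.hom) n).unop c' := by
    apply P.cocycleHom_injective n
    rw [hc]
    exact (ConcreteCategory.congr_hom (congr_arg Quiver.Hom.unop h₃) c').symm
  have h₄ : (F.leftDerived n).map f ≫ (P'.isoHomology R Y n).hom ≫
        (P'.homComplex R Y).homologyι n =
      ((P.isoHomology R Y n).hom ≫ (P.homComplex R Y).homologyι n) ≫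
        HomologicalComplex.opcyclesMap
          ((F.mapHomologicalComplex (ComplexShape.down ℕ)).map φ.hom) n := by
    rw [reassoc_of% h₁, Category.assoc, ← h₂]
  rw [hc']
  exact (ConcreteCategory.congr_hom (congr_arg Quiver.Hom.unop h₄) c').symm

variable [HasExt.{w} C]

variable (R Y) in
/-- The `Ext`-class of an `n`-cocycle. -/
noncomputable def cocycleExt : ((P.homComplex R Y).opcycles n).unop →ₗ[R] Abelian.Ext.{w} X Y n where
  toFun c := P.extMk (P.cocycleHom R Y n c) (n + 1) rfl (P.d_comp_cocycleHom n _ c)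
  map_add' c c' := by simp only [map_add, add_extMk]
  map_smul' r c := by
    rw [RingHom.id_apply, Abelian.Ext.smul_eq_comp_mk₀, extMk_comp_mk₀]
    simp

lemma exists_linearEquiv_ext : ∃ e : ((Ext R C n).obj (op X)).obj Y ≃ₗ[R] Abelian.Ext.{w} X Y n,
    ∀ c, e (P.cocycleClass n c) = P.cocycleExt R Y n c := by
  have hsurj : Function.Surjective (P.cocycleExt R Y n) := fun α ↦ by
    obtain ⟨f, hf, rfl⟩ := P.extMk_surjective α (n + 1) rfl
    obtain ⟨c, rfl⟩ := P.exists_cocycleHom_eq (R := R) n f hf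
    exact ⟨c, rfl⟩
  have hker : LinearMap.ker (P.cocycleClass (R := R) (Y := Y) n) =
      LinearMap.ker (P.cocycleExt R Y n) := by
    ext c
    exact (P.cocycleClass_eq_zero_iff n _ rfl c).trans
      (P.extMk_eq_zero_iff_of_next n _ (P.d_comp_cocycleHom n _ c) _ rfl).symm
  refine ⟨((P.cocycleClass n).quotKerEquivOfSurjective (P.cocycleClass_surjective n)).symm ≪≫ₗ
    Submodule.quotEquivOfEq _ _ hker ≪≫ₗ
      (P.cocycleExt R Y n).quotKerEquivOfSurjective hsurj, fun c ↦ ?_⟩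
  have : ((P.cocycleClass n).quotKerEquivOfSurjective (P.cocycleClass_surjective n)).symm
      (P.cocycleClass n c) = Submodule.Quotient.mk c := by
    rw [LinearEquiv.symm_apply_eq]; rfl
  simp [this]

variable (R X Y) in
/-- The comparison between the two definitions of `Ext`. -/
noncomputable def extLinearEquiv :
    ((Ext R C n).obj (op X)).obj Y ≃ₗ[R] Abelian.Ext.{w} X Y n :=
  ((projectiveResolution X).exists_linearEquiv_ext n).choose

lemma extLinearEquiv_naturality {X' : C} (f : X ⟶ X') (α : ((Ext R C n).obj (op X')).obj Y) :
    extLinearEquiv R X Y n (((Ext R C n).map f.op).app Y α) =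
      (Abelian.Ext.mk₀.{w} f).comp (extLinearEquiv R X' Y n α) (zero_add n) := by
  let P := projectiveResolution X
  let P' := projectiveResolution X'
  let φ : Hom P P' f := ⟨lift f P P', HomologicalComplex.congr_hom (lift_commutes f P P') 0⟩
  obtain ⟨c', rfl⟩ := P'.cocycleClass_surjective n α
  obtain ⟨c, hc⟩ := P.exists_cocycleHom_eq (R := R) n (φ.hom.f n ≫ P'.cocycleHom R Y n c')
    (by rw [← φ.hom.comm_assoc, d_comp_cocycleHom, comp_zero])
  rw [← P.cocycleClass_naturality n φ c c' hc]
  refine ((P.exists_linearEquiv_ext n).choose_spec c).trans ?_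
  rw [show extLinearEquiv R X' Y n (P'.cocycleClass n c') = _ from
    (P'.exists_linearEquiv_ext n).choose_spec c']
  refine Eq.trans ?_ (mk₀_comp_extMk (P'.cocycleHom R Y n c') (n + 1) rfl
    (P'.d_comp_cocycleHom n _ c') φ).symm
  simp only [cocycleExt, LinearMap.coe_mk, AddHom.coe_mk, hc]

end CategoryTheory.ProjectiveResolution

end
section

open localCohomology

variable {R}

lemma ModuleCat.exists_ι_eq_of_isColimit {J : Type} [SmallCategory J] [IsFiltered J]
    {G : J ⥤ ModuleCat.{u} R} {c : Cocone G} (hc : IsColimit c) (z : c.pt) :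
    ∃ j, ∃ y : G.obj j, c.ι.app j y = z :=
  have : PreservesFilteredColimitsOfSize.{0, 0} (forget (ModuleCat.{u} R)) :=
    preservesFilteredColimitsOfSize_shrink _
  Concrete.isColimit_exists_rep G hc z

lemma ModuleCat.ι_injective_of_isColimit {J : Type} [SmallCategory J] [IsFiltered J]
    {G : J ⥤ ModuleCat.{u} R} {c : Cocone G} (hc : IsColimit c)
    (hG : ∀ {i j : J} (f : i ⟶ j), Function.Injective (G.map f)) (j : J) :
    Function.Injective (c.ι.app j) := fun x y hxy ↦ by
  have : PreservesFilteredColimitsOfSize.{0, 0} (forget (ModuleCat.{u} R)) :=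
    preservesFilteredColimitsOfSize_shrink _
  obtain ⟨k, f, g, h⟩ := Concrete.isColimit_exists_of_rep_eq G hc x y hxy
  apply hG (f ≫ IsFiltered.coeqHom f g)
  nth_rw 2 [IsFiltered.coeq_condition]
  simp only [Functor.map_comp, ConcreteCategory.comp_apply, h]

/-- `H^i_I(M)` is the colimit of the modules `Ext^i(R / I ^ n, M)`. -/
noncomputable def localCohomology.isColimit (I : Ideal R) (i : ℕ) (M : ModuleCat.{u} R) :
    IsColimit (((evaluation _ _).obj M).mapCocone
      (colimit.cocone (diagram (idealPowersDiagram I) i))) :=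
  isColimitOfPreserves _ (colimit.isColimit _)

end
section

open Opposite localCohomology

variable {R}

lemma LinearMap.ker_eq_smul_top_of_apply_mk {I J : Ideal R} (f : (R ⧸ J) →ₗ[R] R ⧸ I)
    (hf : ∀ r, f (Ideal.Quotient.mk J r) = Ideal.Quotient.mk I r) :
    LinearMap.ker f = I • (⊤ : Submodule R (R ⧸ J)) := by
  apply le_antisymm
  · intro x hx
    obtain ⟨r, rfl⟩ := Ideal.Quotient.mk_surjective x
    rw [LinearMap.mem_ker, hf, Ideal.Quotient.eq_zero_iff_mem] at hx
    have h : r • (1 : R ⧸ J) = Ideal.Quotient.mk J r := by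
      rw [Algebra.smul_def, mul_one, Ideal.Quotient.algebraMap_eq]
    exact h ▸ Submodule.smul_mem_smul hx trivial
  · rw [Submodule.smul_le]
    intro a ha x _
    obtain ⟨r, rfl⟩ := Ideal.Quotient.mk_surjective x
    rw [LinearMap.mem_ker, map_smul, hf, Algebra.smul_def, Ideal.Quotient.algebraMap_eq,
      Ideal.Quotient.eq_zero_iff_mem.mpr ha, zero_mul]

lemma Submodule.mapQ_id_surjective {N : Type*} [AddCommGroup N] [Module R N]
    {p q : Submodule R N} (h : p ≤ q.comap LinearMap.id) :
    Function.Surjective (p.mapQ q LinearMap.id h) := fun x ↦ by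
  obtain ⟨y, rfl⟩ := q.mkQ_surjective x
  exact ⟨p.mkQ y, rfl⟩

lemma Ideal.Quotient.smul_eq_zero_of_mem {I : Ideal R} {a : R} (ha : a ∈ I) (x : R ⧸ I) :
    a • x = 0 := by
  rw [Algebra.smul_def, Ideal.Quotient.algebraMap_eq, Ideal.Quotient.eq_zero_iff_mem.mpr ha,
    zero_mul]

/-- The `I`-torsion of a module `H` is `Hom(R / I, H)`. -/
lemma nonempty_linearEquiv_linearMap_quotient {I : Ideal R} {E H : Type*} [AddCommGroup E]
    [Module R E] [AddCommGroup H] [Module R H] (Φ : E →ₗ[R] H) (hΦ : Function.Injective Φ)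
    (hrange : ∀ z, z ∈ LinearMap.range Φ ↔ ∀ a ∈ I, a • z = 0) :
    Nonempty (E ≃ₗ[R] ((R ⧸ I) →ₗ[R] H)) := by
  let Ψ : ((R ⧸ I) →ₗ[R] H) →ₗ[R] H := LinearMap.applyₗ (1 : R ⧸ I)
  have hΨ : Function.Injective Ψ := fun g g' h ↦ by
    refine LinearMap.ext fun x ↦ ?_
    obtain ⟨r, rfl⟩ := Ideal.Quotient.mk_surjective x
    rw [← Ideal.Quotient.algebraMap_eq, Algebra.algebraMap_eq_smul_one, map_smul, map_smul]
    exact congrArg (r • ·) h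
  have hrange' : LinearMap.range Φ = LinearMap.range Ψ := by
    ext z
    rw [hrange]
    constructor
    · intro hz
      refine ⟨Submodule.liftQ I (LinearMap.toSpanSingleton R H z) fun a ha ↦ hz a ha, ?_⟩
      exact one_smul R z
    · rintro ⟨g, rfl⟩ a ha
      change a • g 1 = 0
      rw [← map_smul, Ideal.Quotient.smul_eq_zero_of_mem ha, map_zero]
  exact ⟨LinearEquiv.ofInjective Φ hΦ ≪≫ₗ LinearEquiv.ofEq _ _ hrange' ≪≫ₗ
    (LinearEquiv.ofInjective Ψ hΨ).symm⟩

/-- If `Ext^i(N, M)` vanishes for `i < t` and all finitely generated `I`-power torsion `N`, then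
`Ext^t(R / I, M)` embeds in `H^t_I(M)` as the submodule of elements killed by `I`. -/
lemma exists_ext_to_localCohomology [IsNoetherianRing R] {I : Ideal R} {M : ModuleCat.{u} R}
    {t : ℕ}
    (hM : ∀ n : ℕ, ∀ N : ModuleCat.{u} R, Module.Finite R N →
      (∀ a ∈ I ^ n, ∀ x : N, a • x = 0) → ∀ i < t, Subsingleton (Abelian.Ext N M i)) :
    ∃ Φ : extMod R t (ModuleCat.of R (R ⧸ I)) M →ₗ[R] (localCohomology I t).obj M,
      Function.Injective Φ ∧
        ∀ z, z ∈ LinearMap.range Φ ↔ ∀ a ∈ I, a • z = 0 := by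
  let e (N : ModuleCat.{u} R) : extMod R t N M ≃ₗ[R] Abelian.Ext N M t :=
    ProjectiveResolution.extLinearEquiv R N M t
  let F {N N' : ModuleCat.{u} R} (f : N ⟶ N') : extMod R t N' M ⟶ extMod R t N M :=
    ((Ext R (ModuleCat.{u} R) t).map f.op).app M
  have heF {N N' : ModuleCat.{u} R} (f : N ⟶ N') (x : extMod R t N' M) :
      e N (F f x) = (Abelian.Ext.mk₀ f).comp (e N' x) (zero_add t) :=
    ProjectiveResolution.extLinearEquiv_naturality t f x
  have hF_inj {n : ℕ} {N N' : ModuleCat.{u} R} [Module.Finite R N]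
      (hN : ∀ a ∈ I ^ n, ∀ x : N, a • x = 0) (f : N ⟶ N') (hf : Function.Surjective f) :
      Function.Injective (F f) := fun x y hxy ↦ by
    apply (e N').injective
    apply ModuleCat.mk₀_comp_injective_of_surjective (hM n) hN f hf
    simp only [← heF, hxy]
  have hD {i j : ℕᵒᵖ} (f : i ⟶ j) :
      Function.Surjective ((ringModIdeals (idealPowersDiagram I)).map f) :=
    Submodule.mapQ_id_surjective ((idealPowersDiagram I).map f).down.down
  let Q (n : ℕ) : ModuleCat.{u} R := ModuleCat.of R (R ⧸ I ^ n)
  have hQ (n : ℕ) : ∀ a ∈ I ^ n, ∀ x : Q n, a • x = 0 :=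
    fun a ha x ↦ Ideal.Quotient.smul_eq_zero_of_mem ha x
  have hc := localCohomology.isColimit I t M
  let ι (n : ℕ) : extMod R t (Q n) M ⟶ (localCohomology I t).obj M :=
    (colimit.ι (diagram (idealPowersDiagram I) t) (op (op n))).app M
  have hι_inj (n : ℕ) : Function.Injective (ι n) :=
    ModuleCat.ι_injective_of_isColimit hc
      (fun {i j} f ↦ hF_inj (hQ j.unop.unop) _ (hD f.unop)) (op (op n))
  have hι_surj (z : (localCohomology I t).obj M) : ∃ n y, ι n y = z := by
    obtain ⟨j, y, hy⟩ := ModuleCat.exists_ι_eq_of_isColimit hc z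
    exact ⟨j.unop.unop, y, hy⟩
  let p {m n : ℕ} (h : m ≤ n) : Q n ⟶ Q m :=
    (ringModIdeals (idealPowersDiagram I)).map (homOfLE h).op
  have hι {m n : ℕ} (h : m ≤ n) (x : extMod R t (Q m) M) : ι n (F (p h) x) = ι m x :=
    ConcreteCategory.congr_hom (((evaluation _ _).obj M).congr_map
      (colimit.w (diagram (idealPowersDiagram I) t) (homOfLE h).op.op)) x
  let q : Q 1 ⟶ ModuleCat.of R (R ⧸ I) :=
    ModuleCat.ofHom (Submodule.mapQ _ _ LinearMap.id (pow_one I).le)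
  have hq : Function.Surjective q := Submodule.mapQ_id_surjective (pow_one I).le
  refine ⟨(F q ≫ ι 1).hom, (hι_inj 1).comp (hF_inj (hQ 1) q hq), fun z ↦ ⟨?_, fun hz ↦ ?_⟩⟩
  · rintro ⟨x, rfl⟩ a ha
    have h : a • x = 0 := by
      apply (e _).injective
      rw [map_smul, map_zero, ← Abelian.Ext.mk₀_id_comp (e _ x), ← Abelian.Ext.smul_comp,
        ← Abelian.Ext.mk₀_smul]
      have : a • 𝟙 (ModuleCat.of R (R ⧸ I)) = 0 := by
        refine ModuleCat.hom_ext (LinearMap.ext fun x ↦ ?_)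
        exact Ideal.Quotient.smul_eq_zero_of_mem ha x
      rw [this, Abelian.Ext.mk₀_zero, Abelian.Ext.zero_comp]
    rw [← map_smul, h, map_zero]
  · obtain ⟨n, y, rfl⟩ := hι_surj z
    rw [← hι n.le_succ y] at hz ⊢
    obtain ⟨β, hβ⟩ := ModuleCat.exists_mk₀_comp_eq_of_smul_eq_zero (hM (n + 1)) (hQ (n + 1))
      (p (Nat.le_add_left 1 n) ≫ q) (hq.comp (hD _))
      (LinearMap.ker_eq_smul_top_of_apply_mk _ fun r ↦ rfl) (e _ (F (p n.le_succ) y))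
      (fun a ha ↦ by
        rw [← map_smul, map_eq_zero_iff _ (e _).injective]
        apply hι_inj (n + 1)
        rw [map_smul, hz a ha, map_zero])
    obtain ⟨x, rfl⟩ := (e _).surjective β
    refine ⟨x, (hι (Nat.le_add_left 1 n) (F q x)).symm.trans ?_⟩
    congr 1
    apply (e _).injective
    rw [← hβ, heF, heF, Abelian.Ext.mk₀_comp_mk₀_assoc]

end

lemma isZero_extMod_iff {R : Type u} [CommRing R] (n : ℕ) (A B : ModuleCat.{u} R) :
    IsZero (extMod R n A B) ↔ Subsingleton (Abelian.Ext A B n) := by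
  rw [ModuleCat.isZero_iff_subsingleton]
  exact (ProjectiveResolution.extLinearEquiv R A B n).toEquiv.subsingleton_congr

/-- Below the depth of `M`, `Ext^i(N, M)` vanishes for all finitely generated `N`
killed by a power of the maximal ideal. -/
lemma subsingleton_ext_of_lt_moduleDepth {R : Type u} [CommRing R] [IsNoetherianRing R]
    [IsLocalRing R] (M : ModuleCat.{u} R) [Module.Finite R M] [Nontrivial M] (n : ℕ)
    (N : ModuleCat.{u} R) [Module.Finite R N]
    (hN : ∀ a ∈ IsLocalRing.maximalIdeal R ^ n, ∀ x : N, a • x = 0) (i : ℕ)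
    (hi : i < moduleDepth R M) :
    Subsingleton (Abelian.Ext N M i) := by
  obtain ⟨rs, hlen, hmem, hreg⟩ := ModuleCat.exists_isRegular_of_exists_subsingleton_ext
    (IsLocalRing.maximalIdeal R) (i + 1) M
    (maximalIdeal_smul_top_lt R M)
    (ModuleCat.of R (R ⧸ IsLocalRing.maximalIdeal R))
    (by rw [Module.support_eq_zeroLocus, Ideal.annihilator_quotient])
    (fun j hj ↦ (isZero_extMod_iff j _ M).mp
      (not_not.mp (Nat.notMem_of_lt_sInf (lt_of_lt_of_le hj hi))))
  exact ModuleCat.subsingleton_ext_of_exists_isRegular _ N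
    (Module.support_subset_zeroLocus_of_pow_smul_eq_zero hN) M
    (maximalIdeal_smul_top_lt R M) rs hmem hreg i (by lia)

/-- Let `(R, m, k)` be a Noetherian local ring and `M` a finitely generated
nonzero `R`-module with `t = depth M`. Then `Ext^t_R(k, M) ≅ Hom_R(k, H^t_m(M))`, and in
particular `H^t_m(M) ≠ 0`. -/
theorem stmt_5 (R : Type u) [CommRing R] [IsNoetherianRing R] [IsLocalRing R]
    (M : Type u) [AddCommGroup M] [Module R M] [Module.Finite R M] [Nontrivial M]
    (t : ℕ) (ht : t = moduleDepth R (ModuleCat.of R M)) :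
    Nonempty
      ((extMod R t (ModuleCat.of R (R ⧸ IsLocalRing.maximalIdeal R))
          (ModuleCat.of R M)) ≃ₗ[R]
        ((R ⧸ IsLocalRing.maximalIdeal R) →ₗ[R]
          ((localCohomology (IsLocalRing.maximalIdeal R) t).obj (ModuleCat.of R M)))) ∧
    Nontrivial
      ((localCohomology (IsLocalRing.maximalIdeal R) t).obj (ModuleCat.of R M)) := by
  let k := ModuleCat.of R (R ⧸ IsLocalRing.maximalIdeal R)
  let N := ModuleCat.of R M
  subst ht
  obtain ⟨Φ, hΦ, hrange⟩ := exists_ext_to_localCohomology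
    (fun n A _ hA i hi ↦ subsingleton_ext_of_lt_moduleDepth N n A hA i hi)
  have hne : ¬ IsZero (extMod R (moduleDepth R N) k N) := by
    obtain ⟨i, hi⟩ := exists_not_subsingleton_ext_residueField N
    exact Nat.sInf_mem (s := {i | ¬ IsZero (extMod R i k N)})
      ⟨i, (isZero_extMod_iff i k N).not.mpr hi⟩
  refine ⟨nonempty_linearEquiv_linearMap_quotient Φ hΦ hrange, ?_⟩
  rw [ModuleCat.isZero_iff_subsingleton, not_subsingleton_iff_nontrivial] at hne
  exact hΦ.nontrivial
end

section
/- Let (R, m, k) be a complete Cohen-Macaulay Noetherian local ring of dimension d with canonical module ω_R. Then the Lyubeznik numbers λ_{i,j}(R) = dim_k Ext^i_R(k, H^j_m(R)) vanish for j ≠ d, and λ_{i,d}(R) = β_{i}(ω_R), the i-th Betti number of ω_R. -/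
open CategoryTheory CategoryTheory.Limits

universe u

variable (R : Type u) [CommRing R]

/-- `Tor_n^R(A, B)` as an `R`-module. -/
noncomputable def torMod (n : ℕ) (A B : ModuleCat.{u} R) : ModuleCat.{u} R :=
  ((Tor (ModuleCat.{u} R) n).obj A).obj B

namespace LyubeznikBetti

section

variable {R : Type u} [CommRing R]

/-- Two surjective linear maps with the same kernel have isomorphic targets. -/
lemma nonempty_linearEquiv_of_surjective {M N P : Type*} [AddCommGroup M] [AddCommGroup N]
    [AddCommGroup P] [Module R M] [Module R N] [Module R P] (f : M →ₗ[R] N) (g : M →ₗ[R] P)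
    (hf : Function.Surjective f) (hg : Function.Surjective g)
    (h : ∀ x, f x = 0 ↔ g x = 0) : Nonempty (N ≃ₗ[R] P) :=
  ⟨(f.quotKerEquivOfSurjective hf).symm ≪≫ₗ
    Submodule.quotEquivOfEq _ _ (by ext x; simpa using h x) ≪≫ₗ
    g.quotKerEquivOfSurjective hg⟩

/-- Homology of a short complex of modules as a quotient of the submodule of cycles. -/
lemma exists_ker_to_homology (S : ShortComplex (ModuleCat.{u} R)) :
    ∃ π : LinearMap.ker S.g.hom →ₗ[R] S.homology, Function.Surjective π ∧
      ∀ z, π z = 0 ↔ ∃ x, S.f x = (z : S.X₂) := by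
  let e := S.moduleCatHomologyIso.toLinearEquiv.symm
  let p : LinearMap.ker S.g.hom →ₗ[R] S.moduleCatLeftHomologyData.H :=
    (LinearMap.range S.moduleCatToCycles).mkQ
  refine ⟨e.toLinearMap.comp p, e.surjective.comp (Submodule.mkQ_surjective _), fun z ↦ ?_⟩
  refine e.map_eq_zero_iff.trans ((Submodule.Quotient.mk_eq_zero _).trans ?_)
  exact exists_congr fun x ↦ Subtype.ext_iff

/-- Homology of a complex of modules as a quotient of the submodule of cycles. -/
lemma exists_cycles_to_homology {ι : Type*} {c : ComplexShape ι}
    (K : HomologicalComplex (ModuleCat.{u} R) c) (i j k : ι) (hi : c.prev j = i)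
    (hk : c.next j = k) :
    ∃ π : LinearMap.ker (K.d j k).hom →ₗ[R] K.homology j, Function.Surjective π ∧
      ∀ z, π z = 0 ↔ ∃ x, K.d i j x = (z : K.X j) := by
  obtain ⟨π, hπ, hπ0⟩ := exists_ker_to_homology (K.sc' i j k)
  let e := (ShortComplex.homologyMapIso (K.isoSc' i j k hi hk)).toLinearEquiv.symm
  exact ⟨e.toLinearMap.comp π, e.surjective.comp hπ,
    fun z ↦ e.map_eq_zero_iff.trans (hπ0 z)⟩

lemma projective_extMk_eq_zero_iff {X Y : ModuleCat.{u} R} (P : ProjectiveResolution X) {n : ℕ}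
    (f : P.complex.X n ⟶ Y) (hf : P.complex.d (n + 1) n ≫ f = 0) :
    P.extMk f (n + 1) rfl hf = 0 ↔
      ∃ g : P.complex.X ((ComplexShape.up ℕ).prev n) ⟶ Y, P.complex.d n _ ≫ g = f := by
  rcases n with _ | n
  · have h0 : P.complex.d 0 ((ComplexShape.up ℕ).prev 0) = 0 := P.complex.shape _ _ (by simp)
    have hz : IsZero (P.cochainComplex.X 1) :=
      CochainComplex.isZero_of_isStrictlyLE _ 0 _
    rw [← P.extEquivCohomologyClass.apply_eq_iff_eq,
      ProjectiveResolution.extEquivCohomologyClass_extMk,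
      ProjectiveResolution.extEquivCohomologyClass_zero,
      CochainComplex.HomComplex.CohomologyClass.mk_eq_zero_iff]
    rw [CochainComplex.HomComplex.Cocycle.toSingleMk_mem_coboundaries_iff _ _ _ _ _ 1 (by simp)]
    have h1 : ∀ g : P.cochainComplex.X 1 ⟶ Y, g = 0 := fun g ↦ hz.eq_of_src _ _
    constructor
    · rintro ⟨g, hg⟩
      rw [h1 g, comp_zero, eq_comm, Preadditive.IsIso.comp_left_eq_zero] at hg
      exact ⟨0, by rw [hg, comp_zero]⟩
    · rintro ⟨g, rfl⟩
      exact ⟨0, by rw [h0, zero_comp, comp_zero, comp_zero]⟩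
  · rw [P.extMk_eq_zero_iff f _ rfl hf n rfl,
      show (ComplexShape.up ℕ).prev (n + 1) = n by simp]

lemma injective_extMk_eq_zero_iff {X Y : ModuleCat.{u} R} (I : InjectiveResolution Y) {n : ℕ}
    (f : X ⟶ I.cocomplex.X n) (hf : f ≫ I.cocomplex.d n (n + 1) = 0) :
    I.extMk f (n + 1) rfl hf = 0 ↔
      ∃ g : X ⟶ I.cocomplex.X ((ComplexShape.up ℕ).prev n), g ≫ I.cocomplex.d _ n = f := by
  rcases n with _ | n
  · have h0 : I.cocomplex.d ((ComplexShape.up ℕ).prev 0) 0 = 0 := I.cocomplex.shape _ _ (by simp)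
    have hz : IsZero (I.cochainComplex.X (-1)) :=
      CochainComplex.isZero_of_isStrictlyGE _ 0 _ (by lia)
    rw [← I.extEquivCohomologyClass.apply_eq_iff_eq,
      InjectiveResolution.extEquivCohomologyClass_extMk,
      InjectiveResolution.extEquivCohomologyClass_zero,
      CochainComplex.HomComplex.CohomologyClass.mk_eq_zero_iff]
    rw [CochainComplex.HomComplex.Cocycle.fromSingleMk_mem_coboundaries_iff _ _ _ _ _ (-1)
      (by simp)]
    have h1 : ∀ g : X ⟶ I.cochainComplex.X (-1), g = 0 := fun g ↦ hz.eq_of_tgt _ _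
    constructor
    · rintro ⟨g, hg⟩
      rw [h1 g, zero_comp, eq_comm, Preadditive.IsIso.comp_right_eq_zero] at hg
      exact ⟨0, by rw [hg, zero_comp]⟩
    · rintro ⟨g, rfl⟩
      exact ⟨0, by rw [h0, comp_zero, zero_comp, zero_comp]⟩
  · rw [I.extMk_eq_zero_iff f _ rfl hf n rfl,
      show (ComplexShape.up ℕ).prev (n + 1) = n by simp]

lemma smul_projective_extMk {X Y : ModuleCat.{u} R} (P : ProjectiveResolution X) {n : ℕ} (r : R)
    (f : P.complex.X n ⟶ Y) (hf : P.complex.d (n + 1) n ≫ f = 0) :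
    r • P.extMk f (n + 1) rfl hf = P.extMk (r • f) (n + 1) rfl (by simp [hf]) := by
  simp [Abelian.Ext.smul_eq_comp_mk₀, P.extMk_comp_mk₀]

lemma smul_injective_extMk {X Y : ModuleCat.{u} R} (I : InjectiveResolution Y) {n : ℕ} (r : R)
    (f : X ⟶ I.cocomplex.X n) (hf : f ≫ I.cocomplex.d n (n + 1) = 0) :
    r • I.extMk f (n + 1) rfl hf = I.extMk (r • f) (n + 1) rfl (by simp [hf]) := by
  have h : r • I.extMk f (n + 1) rfl hf =
      (Abelian.Ext.mk₀ (r • 𝟙 X)).comp (I.extMk f (n + 1) rfl hf) (zero_add _) := by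
    simp [Abelian.Ext.mk₀_smul]
  simp [h, I.mk₀_comp_extMk]

/-- The `Ext` obtained by deriving agrees with the `Ext` of the derived category. -/
lemma nonempty_extMod_equiv (n : ℕ) (A B : ModuleCat.{u} R) :
    Nonempty (extMod R n A B ≃ₗ[R] Abelian.Ext.{u} A B n) := by
  let P := ProjectiveResolution.of A
  let K := P.complex.linearYonedaObj R B
  obtain ⟨π, hπ, hπ0⟩ := exists_cycles_to_homology K _ n (n + 1) rfl (by simp)
  have hz (z : LinearMap.ker (K.d n (n + 1)).hom) :
      P.complex.d (n + 1) n ≫ (z.1 : P.complex.X n ⟶ B) = 0 := z.2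
  let φ : LinearMap.ker (K.d n (n + 1)).hom →ₗ[R] Abelian.Ext.{u} A B n :=
    { toFun z := P.extMk z.1 (n + 1) rfl (hz z)
      map_add' z w := (P.add_extMk _ _ _ _ (hz z) (hz w)).symm
      map_smul' r z := (smul_projective_extMk P r _ (hz z)).symm }
  obtain ⟨e⟩ := nonempty_linearEquiv_of_surjective π φ hπ (fun α ↦ by
    obtain ⟨f, hf, rfl⟩ := P.extMk_surjective α (n + 1) rfl
    exact ⟨⟨f, hf⟩, rfl⟩) (fun z ↦ (hπ0 z).trans
      (projective_extMk_eq_zero_iff P _ (hz z)).symm)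
  exact ⟨(P.isoExt n B).toLinearEquiv ≪≫ₗ e⟩

section

variable [IsNoetherianRing R]

lemma projective_of_fin (n : ℕ) : Projective (FGModuleCat.of R (Fin n → R)) := by
  refine ⟨fun {E X} f e he ↦ ?_⟩
  have : Epi ((forget₂ (FGModuleCat.{u} R) (ModuleCat.{u} R)).map e) := inferInstance
  obtain ⟨g, hg⟩ := Module.projective_lifting_property e.hom.hom f.hom.hom
    ((ModuleCat.epi_iff_surjective ((forget₂ (FGModuleCat.{u} R) (ModuleCat.{u} R)).map e)).mp this)
  exact ⟨ObjectProperty.homMk (ModuleCat.ofHom g), FGModuleCat.hom_ext hg⟩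

lemma exists_epi_of_fin (M : FGModuleCat.{u} R) :
    ∃ (n : ℕ) (f : FGModuleCat.of R (Fin n → R) ⟶ M), Epi f := by
  obtain ⟨n, f, hf⟩ := Module.Finite.exists_fin' R M
  refine ⟨n, ObjectProperty.homMk (ModuleCat.ofHom f), ?_⟩
  exact (forget₂ (FGModuleCat.{u} R) (ModuleCat.{u} R)).epi_of_epi_map
    ((ModuleCat.epi_iff_surjective (ModuleCat.ofHom f)).mpr hf)

instance : EnoughProjectives (FGModuleCat.{u} R) where
  presentation M := by
    obtain ⟨n, f, hf⟩ := exists_epi_of_fin M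
    have := projective_of_fin (R := R) n
    exact ⟨⟨_, f⟩⟩

instance : (forget₂ (FGModuleCat.{u} R) (ModuleCat.{u} R)).PreservesProjectiveObjects where
  projective_obj {X} hX := by
    obtain ⟨n, f, hf⟩ := exists_epi_of_fin X
    have : Projective (ModuleCat.of R (Fin n → R)) :=
      (ModuleCat.of R (Fin n → R)).projective_of_categoryTheory_projective
    let r : Retract X (FGModuleCat.of R (Fin n → R)) :=
      ⟨Projective.factorThru (𝟙 X) f, f, Projective.factorThru_comp _ _⟩
    exact (r.map (forget₂ (FGModuleCat.{u} R) (ModuleCat.{u} R))).projective (p := this)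

/-- A finite module over a Noetherian ring has a resolution by finite projective modules. -/
lemma exists_projectiveResolution_finite (M : Type u) [AddCommGroup M] [Module R M]
    [Module.Finite R M] :
    ∃ P : ProjectiveResolution (ModuleCat.of R M), ∀ n, Module.Finite R (P.complex.X n) := by
  let F := forget₂ (FGModuleCat.{u} R) (ModuleCat.{u} R)
  let Q := ProjectiveResolution.of (FGModuleCat.of R M)
  exact ⟨F.mapProjectiveResolution Q, fun n ↦ (Q.complex.X n).property⟩

end

/-- Mapping into an injective module is exact. -/
lemma exists_comp_eq_of_exact {A B C E : Type u} [AddCommGroup A] [AddCommGroup B]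
    [AddCommGroup C] [AddCommGroup E] [Module R A] [Module R B] [Module R C] [Module R E]
    (hE : Module.Injective R E) {a : A →ₗ[R] B} {b : B →ₗ[R] C} (hab : Function.Exact a b)
    (f : B →ₗ[R] E) (hf : f ∘ₗ a = 0) : ∃ g : C →ₗ[R] E, g ∘ₗ b = f := by
  have hker : LinearMap.ker b ≤ LinearMap.ker f := by
    rw [hab.linearMap_ker_eq]
    rintro _ ⟨x, rfl⟩
    exact LinearMap.congr_fun hf x
  obtain ⟨g, hg⟩ := Module.Injective.extension_property R _ _ _
    ((LinearMap.ker b).liftQ b le_rfl)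
    (LinearMap.ker_eq_bot.mp (Submodule.ker_liftQ_eq_bot _ _ _ le_rfl))
    ((LinearMap.ker b).liftQ f hker)
  refine ⟨g, ?_⟩
  ext x
  exact LinearMap.congr_fun hg (Submodule.Quotient.mk x)

/-- The module of maps from a flat module to an injective module is injective. -/
lemma injective_linearMap_of_flat {M E : Type u} [AddCommGroup M] [AddCommGroup E] [Module R M]
    [Module R E] [Module.Flat R M] (hE : Module.Injective R E) :
    Module.Injective R (M →ₗ[R] E) := by
  refine ⟨fun X Y _ _ _ _ i hi f ↦ ?_⟩
  obtain ⟨h, hh⟩ := Module.Injective.extension_property R _ _ _ (i.rTensor M)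
    (Module.Flat.rTensor_preserves_injective_linearMap i hi) (TensorProduct.lift f)
  refine ⟨TensorProduct.curry h, fun x ↦ ?_⟩
  ext m
  exact LinearMap.congr_fun hh (TensorProduct.tmul R x m)

/-- An exact complex of injectives starting with `X` is an injective resolution of `X`. -/
lemma exists_injectiveResolution {C : Type*} [Category* C] [Abelian C]
    (K : CochainComplex C ℕ) (hinj : ∀ n, Injective (K.X n)) {X : C}
    (ι : X ⟶ K.X 0) [Mono ι] (hιd : ι ≫ K.d 0 1 = 0) (h₀ : (ShortComplex.mk _ _ hιd).Exact)
    (hK : ∀ n, K.ExactAt (n + 1)) :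
    ∃ I : InjectiveResolution X, I.cocomplex = K := by
  refine ⟨{ cocomplex := K
            injective := hinj
            ι := (CochainComplex.fromSingle₀Equiv _ _).symm ⟨ι, hιd⟩
            quasiIso := ⟨fun n ↦ ?_⟩ }, rfl⟩
  cases n with
  | zero =>
    rw [CochainComplex.quasiIsoAt₀_iff, ShortComplex.quasiIso_iff_of_zeros]
    · refine (ShortComplex.exact_and_mono_f_iff_of_iso ?_).2 ⟨h₀, inferInstance⟩
      exact ShortComplex.isoMk (Iso.refl _) (Iso.refl _) (Iso.refl _)
        (by simp; exact (Category.id_comp ι).trans (Category.comp_id ι).symm)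
        (by simp; exact (Category.id_comp (K.d 0 1)).trans (Category.comp_id (K.d 0 1)).symm)
    · rfl
    · rfl
    · exact K.shape _ _ (by simp)
  | succ n =>
    rw [quasiIsoAt_iff_exactAt]
    · exact hK n
    · apply CochainComplex.exactAt_succ_single_obj

/-- Dualizing a projective resolution into an injective module gives an injective resolution. -/
lemma exists_injectiveResolution_dual {M E : Type u} [AddCommGroup M] [AddCommGroup E]
    [Module R M] [Module R E] (hE : Module.Injective R E)
    (P : ProjectiveResolution (ModuleCat.of R M)) :
    ∃ I : InjectiveResolution (ModuleCat.of R (M →ₗ[R] E)),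
      I.cocomplex = P.complex.linearYonedaObj R (ModuleCat.of R E) := by
  let K := P.complex.linearYonedaObj R (ModuleCat.of R E)
  let π : P.complex.X 0 ⟶ ModuleCat.of R M := P.π.f 0
  have hπd : P.complex.d 1 0 ≫ π = 0 := P.complex_d_comp_π_f_zero
  have hπ : Function.Surjective π :=
    (ModuleCat.epi_iff_surjective π).mp (inferInstanceAs (Epi (P.π.f 0)))
  have hex₀ : Function.Exact (P.complex.d 1 0).hom π.hom :=
    (ShortComplex.ShortExact.moduleCat_exact_iff_function_exact _).mp P.exact₀
  have hex (n : ℕ) : Function.Exact (P.complex.d (n + 2) (n + 1)).hom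
      (P.complex.d (n + 1) n).hom :=
    (ShortComplex.ShortExact.moduleCat_exact_iff_function_exact _).mp (P.exact_succ n)
  have hinj (n : ℕ) : Injective (K.X n) := by
    have hE' : Module.Injective R (P.complex.X n →ₗ[R] E) := injective_linearMap_of_flat hE
    have := Module.injective_object_of_injective_module R (P.complex.X n →ₗ[R] E)
    exact Injective.of_iso (LinearEquiv.toModuleIso
      (ModuleCat.homLinearEquiv (S := R) (M := P.complex.X n) (N := ModuleCat.of R E)).symm) this
  let ι₀ : ModuleCat.of R (M →ₗ[R] E) ⟶ K.X 0 := ModuleCat.ofHom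
    { toFun f := (π ≫ ModuleCat.ofHom f : P.complex.X 0 ⟶ ModuleCat.of R E)
      map_add' _ _ := rfl
      map_smul' _ _ := rfl }
  have hι₀d : ι₀ ≫ K.d 0 1 = 0 := ModuleCat.hom_ext <| LinearMap.ext fun f ↦ by
    have h : P.complex.d 1 0 ≫ π ≫ ModuleCat.ofHom f = 0 := by rw [reassoc_of% hπd, zero_comp]
    exact h
  have hmono : Mono ι₀ := by
    rw [ModuleCat.mono_iff_injective]
    intro f g hfg
    have := (ModuleCat.epi_iff_surjective π).mpr hπ
    exact congrArg ModuleCat.Hom.hom ((cancel_epi π).mp hfg)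
  have hK₀ : (ShortComplex.mk _ _ hι₀d).Exact := by
    rw [ShortComplex.moduleCat_exact_iff]
    intro f hf
    obtain ⟨g, hg⟩ := exists_comp_eq_of_exact hE hex₀ (ModuleCat.Hom.hom f)
      (congrArg ModuleCat.Hom.hom hf)
    exact ⟨g, ModuleCat.hom_ext hg⟩
  have hK (n : ℕ) : K.ExactAt (n + 1) := by
    rw [HomologicalComplex.exactAt_iff' _ n (n + 1) (n + 1 + 1) (by simp) (by simp),
      ShortComplex.moduleCat_exact_iff]
    intro f hf
    obtain ⟨g, hg⟩ := exists_comp_eq_of_exact hE (hex n) (ModuleCat.Hom.hom f)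
      (congrArg ModuleCat.Hom.hom hf)
    exact ⟨ModuleCat.ofHom g, ModuleCat.hom_ext hg⟩
  exact exists_injectiveResolution K hinj ι₀ hι₀d hK₀ hK

/-- Mapping into an injective module commutes with homology. -/
lemma exists_cocycles_to_dual {A B C H E : Type u} [AddCommGroup A] [AddCommGroup B]
    [AddCommGroup C] [AddCommGroup H] [AddCommGroup E] [Module R A] [Module R B] [Module R C]
    [Module R H] [Module R E] (hE : Module.Injective R E) (a : A →ₗ[R] B) (b : B →ₗ[R] C)
    (hab : b ∘ₗ a = 0) (π : LinearMap.ker b →ₗ[R] H) (hπ : Function.Surjective π)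
    (hπ0 : ∀ z, π z = 0 ↔ ∃ x, a x = z) :
    ∃ ρ : LinearMap.ker (a.lcomp R E) →ₗ[R] (H →ₗ[R] E), Function.Surjective ρ ∧
      ∀ f, ρ f = 0 ↔ ∃ g : C →ₗ[R] E, g ∘ₗ b = f := by
  have hf0 (f : LinearMap.ker (a.lcomp R E)) (x : A) : f.1 (a x) = 0 := LinearMap.congr_fun f.2 x
  have hker (f : LinearMap.ker (a.lcomp R E)) :
      LinearMap.ker π ≤ LinearMap.ker (f.1 ∘ₗ (LinearMap.ker b).subtype) := fun z hz ↦ by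
    obtain ⟨x, hx⟩ := (hπ0 z).mp hz
    simp [← hx, hf0]
  let r (f : LinearMap.ker (a.lcomp R E)) : H →ₗ[R] E :=
    (LinearMap.ker π).liftQ _ (hker f) ∘ₗ (π.quotKerEquivOfSurjective hπ).symm.toLinearMap
  have hr (f) (z) : r f (π z) = f.1 z := by
    have : (π.quotKerEquivOfSurjective hπ).symm (π z) = Submodule.Quotient.mk z := by
      rw [LinearEquiv.symm_apply_eq]; rfl
    simp [r, this]
  have hext {f g : H →ₗ[R] E} (h : ∀ z, f (π z) = g (π z)) : f = g := by
    ext x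
    obtain ⟨z, rfl⟩ := hπ x
    exact h z
  refine ⟨{ toFun := r
            map_add' f g := hext fun z ↦ by simp [hr]
            map_smul' c f := hext fun z ↦ by simp [hr] }, fun h ↦ ?_, fun f ↦ ⟨fun hf ↦ ?_, ?_⟩⟩
  · obtain ⟨f, hf⟩ := Module.Injective.extension_property R _ _ _ (LinearMap.ker b).subtype
      Subtype.val_injective (h ∘ₗ π)
    refine ⟨⟨f, ?_⟩, hext fun z ↦ (hr _ z).trans (LinearMap.congr_fun hf z)⟩
    ext x
    have hx : a x ∈ LinearMap.ker b := LinearMap.congr_fun hab x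
    have h1 : f (a x) = h (π ⟨a x, hx⟩) := LinearMap.congr_fun hf ⟨a x, hx⟩
    rw [(hπ0 ⟨a x, hx⟩).mpr ⟨x, rfl⟩, map_zero] at h1
    exact h1
  · refine exists_comp_eq_of_exact hE (a := (LinearMap.ker b).subtype)
      (LinearMap.exact_subtype_ker_map b) f.1 ?_
    ext z
    exact (hr f z).symm.trans (LinearMap.congr_fun hf (π z))
  · rintro ⟨g, hg⟩
    refine hext fun z ↦ (hr f z).trans ?_
    rw [← hg]
    simp

/-- `Ext` as a quotient of the cocycles given by an injective resolution. -/
lemma exists_cocycles_to_ext {X Y : ModuleCat.{u} R} (I : InjectiveResolution Y)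
    (K : CochainComplex (ModuleCat.{u} R) ℕ) (hK : I.cocomplex = K) (n : ℕ) :
    ∃ φ : LinearMap.ker (Linear.rightComp R X (K.d n (n + 1))) →ₗ[R] Abelian.Ext.{u} X Y n,
      Function.Surjective φ ∧
      ∀ f, φ f = 0 ↔ ∃ g : X ⟶ K.X ((ComplexShape.up ℕ).prev n), g ≫ K.d _ n = f := by
  subst hK
  refine ⟨{ toFun f := I.extMk f.1 (n + 1) rfl f.2
            map_add' f g := (I.add_extMk _ _ _ _ f.2 g.2).symm
            map_smul' r f := (smul_injective_extMk I r _ f.2).symm }, fun α ↦ ?_, fun f ↦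
    injective_extMk_eq_zero_iff I _ f.2⟩
  obtain ⟨f, hf, rfl⟩ := I.extMk_surjective α (n + 1) rfl
  exact ⟨⟨f, hf⟩, rfl⟩

/-- `Ext` into the dual of `M` is the dual of `Tor` with `M`. -/
lemma nonempty_ext_dual_equiv {M E : Type u} [AddCommGroup M] [AddCommGroup E]
    [Module R M] [Module R E] (hE : Module.Injective R E) (X : ModuleCat.{u} R) (n : ℕ) :
    Nonempty (Abelian.Ext.{u} X (ModuleCat.of R (M →ₗ[R] E)) n ≃ₗ[R]
      (torMod R n X (ModuleCat.of R M) →ₗ[R] E)) := by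
  let P := ProjectiveResolution.of (ModuleCat.of R M)
  let F := (MonoidalCategory.tensoringLeft (ModuleCat.{u} R)).obj X
  let L := (F.mapHomologicalComplex (ComplexShape.down ℕ)).obj P.complex
  let K := P.complex.linearYonedaObj R (ModuleCat.of R E)
  let p := (ComplexShape.up ℕ).prev n
  let e : torMod R n X (ModuleCat.of R M) ≃ₗ[R] L.homology n :=
    (P.isoLeftDerivedObj F n).toLinearEquiv
  obtain ⟨I, hI⟩ := exists_injectiveResolution_dual hE P
  obtain ⟨φ, hφ, hφ0⟩ := exists_cocycles_to_ext (X := X) I K hI n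
  obtain ⟨π, hπ, hπ0⟩ := exists_cycles_to_homology L (n + 1) n p (by simp)
    (by cases n <;> simp [p])
  obtain ⟨ρ, hρ, hρ0⟩ := exists_cocycles_to_dual hE (L.d (n + 1) n).hom (L.d n p).hom
    (congrArg ModuleCat.Hom.hom (L.d_comp_d _ _ _)) π hπ hπ0
  let v (m : ℕ) : (X →ₗ[R] (P.complex.X m ⟶ ModuleCat.of R E)) ≃ₗ[R] (X ⟶ K.X m) :=
    (ModuleCat.homLinearEquiv (S := R) (M := X) (N := K.X m)).symm
  let u (m : ℕ) : (L.X m →ₗ[R] E) ≃ₗ[R] (X ⟶ K.X m) :=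
    (TensorProduct.lift.equiv (.id R) X (P.complex.X m) E).symm ≪≫ₗ
      LinearEquiv.congrRight (ModuleCat.homLinearEquiv (S := R) (M := P.complex.X m)
        (N := ModuleCat.of R E)).symm ≪≫ₗ v m
  have hu (m l : ℕ) (f : L.X m →ₗ[R] E) : u l (f ∘ₗ (L.d l m).hom) = u m f ≫ K.d m l := rfl
  have hu' : LinearMap.ker ((L.d (n + 1) n).hom.lcomp R E) = (LinearMap.ker
      (Linear.rightComp R X (K.d n (n + 1)))).comap (u n).toLinearMap := by
    ext f
    exact (u (n + 1)).map_eq_zero_iff.symm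
  have hb (f : L.X n →ₗ[R] E) : (∃ g : X ⟶ K.X p, g ≫ K.d p n = u n f) ↔
      ∃ g : L.X p →ₗ[R] E, g ∘ₗ (L.d n p).hom = f := by
    refine (u p).symm.toEquiv.exists_congr fun g ↦ ?_
    rw [← (u n).injective.eq_iff]
    exact Eq.congr_left (((hu p n ((u p).symm g)).trans (by rw [LinearEquiv.apply_symm_apply])).symm)
  obtain ⟨e'⟩ := nonempty_linearEquiv_of_surjective
    (φ ∘ₗ ((u n).ofSubmodule' _).toLinearMap ∘ₗ (LinearEquiv.ofEq _ _ hu').toLinearMap) ρ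
    (hφ.comp (((u n).ofSubmodule' _).surjective.comp (LinearEquiv.ofEq _ _ hu').surjective)) hρ
    (fun f ↦ (hφ0 _).trans <| (hb f).trans (hρ0 f).symm)
  exact ⟨e' ≪≫ₗ e.symm.congrLeft E R⟩

lemma torMod_finite [IsNoetherianRing R] (X : ModuleCat.{u} R) [Module.Finite R X] (M : Type u)
    [AddCommGroup M] [Module R M] [Module.Finite R M] (n : ℕ) :
    Module.Finite R (torMod R n X (ModuleCat.of R M)) := by
  obtain ⟨P, hP⟩ := exists_projectiveResolution_finite (R := R) M
  let F := (MonoidalCategory.tensoringLeft (ModuleCat.{u} R)).obj X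
  let L := (F.mapHomologicalComplex (ComplexShape.down ℕ)).obj P.complex
  obtain ⟨π, hπ, -⟩ := exists_cycles_to_homology L _ n _ rfl rfl
  have hP' := hP n
  have : Module.Finite R (L.X n) :=
    inferInstanceAs (Module.Finite R (TensorProduct R X (P.complex.X n)))
  have : Module.Finite R (L.homology n) := Module.Finite.of_surjective π hπ
  let e : torMod R n X (ModuleCat.of R M) ≃ₗ[R] L.homology n :=
    (P.isoLeftDerivedObj F n).toLinearEquiv
  exact Module.Finite.equiv e.symm

lemma smul_torMod_eq_zero {r : R} {X : ModuleCat.{u} R} (hr : ∀ x : X, r • x = 0)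
    (M : ModuleCat.{u} R) (n : ℕ) (t : torMod R n X M) : r • t = 0 := by
  let P := ProjectiveResolution.of M
  let F := (MonoidalCategory.tensoringLeft (ModuleCat.{u} R)).obj X
  let L := (F.mapHomologicalComplex (ComplexShape.down ℕ)).obj P.complex
  obtain ⟨π, hπ, -⟩ := exists_cycles_to_homology L _ n _ rfl rfl
  have hL (y : TensorProduct R X (P.complex.X n)) : r • y = 0 := by
    induction y with
    | zero => simp
    | tmul x p => rw [TensorProduct.smul_tmul', hr, TensorProduct.zero_tmul]
    | add x y hx hy => rw [smul_add, hx, hy, add_zero]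
  let e : torMod R n X M ≃ₗ[R] L.homology n := (P.isoLeftDerivedObj F n).toLinearEquiv
  obtain ⟨z, hz⟩ := hπ (e t)
  have hz0 : r • z = 0 := Subtype.ext (hL z.1)
  rw [← e.map_eq_zero_iff, map_smul, ← hz, ← map_smul, hz0, map_zero]

section

variable [IsLocalRing R]

/-- The dual of the residue field into an essential extension is the residue field. -/
lemma nonempty_residueField_equiv_dual {E : Type u} [AddCommGroup E] [Module R E]
    (ι : (R ⧸ IsLocalRing.maximalIdeal R) →ₗ[R] E) (hι : Function.Injective ι)
    (hess : ∀ N : Submodule R E, N ≠ ⊥ → LinearMap.range ι ⊓ N ≠ ⊥) :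
    Nonempty ((R ⧸ IsLocalRing.maximalIdeal R) ≃ₗ[R]
      ((R ⧸ IsLocalRing.maximalIdeal R) →ₗ[R] E)) := by
  let ψ : (R ⧸ IsLocalRing.maximalIdeal R) →ₗ[R] ((R ⧸ IsLocalRing.maximalIdeal R) →ₗ[R] E) :=
    { toFun c := ι ∘ₗ LinearMap.mulLeft R c
      map_add' _ _ := by ext; simp
      map_smul' _ _ := by ext; simp }
  have hψ (c x) : ψ c x = ι (c * x) := rfl
  refine ⟨LinearEquiv.ofBijective ψ ⟨(injective_iff_map_eq_zero _).mpr fun c hc ↦ ?_, fun f ↦ ?_⟩⟩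
  · have h := LinearMap.congr_fun hc 1
    rw [hψ, mul_one] at h
    exact hι (h.trans (map_zero ι).symm)
  · have hf (r : R) : r • f 1 = f (Ideal.Quotient.mk _ r) := by
      rw [← map_smul, Algebra.smul_def, mul_one]
      rfl
    suffices h : ∃ c, ι c = f 1 by
      obtain ⟨c, hc⟩ := h
      refine ⟨c, LinearMap.ext fun x ↦ ?_⟩
      obtain ⟨r, rfl⟩ := Ideal.Quotient.mk_surjective x
      rw [← hf, ← hc, ← map_smul, hψ, mul_comm, Algebra.smul_def]
      rfl
    by_cases h1 : f 1 = 0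
    · exact ⟨0, by simp [h1]⟩
    · obtain ⟨y, hy, hy0⟩ := (Submodule.ne_bot_iff _).mp
        (hess (Submodule.span R {f 1}) (by simpa using h1))
      obtain ⟨⟨c, hc⟩, hyf⟩ := Submodule.mem_inf.mp hy
      obtain ⟨r, rfl⟩ := Submodule.mem_span_singleton.mp hyf
      have hr : IsUnit r := by
        by_contra hr
        refine hy0 ?_
        rw [hf, Ideal.Quotient.eq_zero_iff_mem.mpr ((IsLocalRing.mem_maximalIdeal _).mpr hr),
          map_zero]
      obtain ⟨s, rfl⟩ := hr
      refine ⟨(↑s⁻¹ : R) • c, ?_⟩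
      rw [map_smul, hc, smul_smul, Units.inv_mul, one_smul]

/-- A finite-dimensional vector space over the residue field is isomorphic to its dual. -/
lemma nonempty_dual_equiv {T E : Type u} [AddCommGroup T] [Module R T] [Module.Finite R T]
    (hT : ∀ r ∈ IsLocalRing.maximalIdeal R, ∀ t : T, r • t = 0) [AddCommGroup E] [Module R E]
    (e : (R ⧸ IsLocalRing.maximalIdeal R) ≃ₗ[R] ((R ⧸ IsLocalRing.maximalIdeal R) →ₗ[R] E)) :
    Nonempty ((T →ₗ[R] E) ≃ₗ[R] T) := by
  let _ : Field (R ⧸ IsLocalRing.maximalIdeal R) := Ideal.Quotient.field _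
  have hT' : Module.IsTorsionBySet R T (IsLocalRing.maximalIdeal R : Set R) :=
    fun t r ↦ hT r r.2 t
  let _ : Module (R ⧸ IsLocalRing.maximalIdeal R) T := hT'.module
  have : IsScalarTower R (R ⧸ IsLocalRing.maximalIdeal R) T := hT'.isScalarTower
  have : Module.Finite (R ⧸ IsLocalRing.maximalIdeal R) T :=
    Module.Finite.of_restrictScalars_finite R _ T
  let b := (Module.finBasis (R ⧸ IsLocalRing.maximalIdeal R) T).equivFun.restrictScalars R
  exact ⟨b.congrLeft E R ≪≫ₗ (LinearMap.lsum R (fun _ ↦ R ⧸ IsLocalRing.maximalIdeal R) R).symm ≪≫ₗ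
    LinearEquiv.piCongrRight (fun _ ↦ e.symm) ≪≫ₗ b.symm⟩

lemma nonempty_extMod_dual_equiv_torMod [IsNoetherianRing R]
    {E : Type u} [AddCommGroup E] [Module R E] (hE : Module.Injective R E)
    (ι : (R ⧸ IsLocalRing.maximalIdeal R) →ₗ[R] E) (hι : Function.Injective ι)
    (hess : ∀ N : Submodule R E, N ≠ ⊥ → LinearMap.range ι ⊓ N ≠ ⊥)
    (M : Type u) [AddCommGroup M] [Module R M] [Module.Finite R M]
    (H : ModuleCat.{u} R) (h : H ≃ₗ[R] (M →ₗ[R] E)) (i : ℕ) :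
    Nonempty (extMod R i (ModuleCat.of R (R ⧸ IsLocalRing.maximalIdeal R)) H ≃ₗ[R]
      torMod R i (ModuleCat.of R (R ⧸ IsLocalRing.maximalIdeal R)) (ModuleCat.of R M)) := by
  let k := ModuleCat.of R (R ⧸ IsLocalRing.maximalIdeal R)
  let e₁ : extMod R i k H ≃ₗ[R] extMod R i k (ModuleCat.of R (M →ₗ[R] E)) :=
    (((Ext R (ModuleCat.{u} R) i).obj (Opposite.op k)).mapIso
      (h.toModuleIso : H ≅ ModuleCat.of R (M →ₗ[R] E))).toLinearEquiv
  obtain ⟨e₂⟩ := nonempty_extMod_equiv i k (ModuleCat.of R (M →ₗ[R] E))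
  obtain ⟨e₃⟩ := nonempty_ext_dual_equiv (M := M) hE k i
  obtain ⟨e₄⟩ := nonempty_residueField_equiv_dual ι hι hess
  have : Module.Finite R (torMod R i k (ModuleCat.of R M)) := torMod_finite k M i
  obtain ⟨e₅⟩ := nonempty_dual_equiv (T := torMod R i k (ModuleCat.of R M)) (fun r hr t ↦
    smul_torMod_eq_zero (fun x ↦ by
      obtain ⟨y, rfl⟩ := Ideal.Quotient.mk_surjective x
      exact (Ideal.Quotient.eq_zero_iff_mem.mpr (Ideal.mul_mem_right y _ hr) :)) _ _ t) e₄
  exact ⟨e₁ ≪≫ₗ e₂ ≪≫ₗ e₃ ≪≫ₗ e₅⟩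

end

/-- Local cohomology vanishes when the ideals with vanishing `Ext` are cofinal. -/
lemma isZero_localCohomology (I : Ideal R) (M : ModuleCat.{u} R) (j : ℕ)
    (h : ∀ t, ∃ (s : ℕ) (J : Ideal R), I ^ s ≤ J ∧ J ≤ I ^ t ∧
      IsZero (extMod R j (ModuleCat.of R (R ⧸ J)) M)) :
    IsZero ((localCohomology I j).obj M) := by
  let F := localCohomology.diagram (localCohomology.idealPowersDiagram I) j
  let c := ((evaluation (ModuleCat.{u} R) (ModuleCat.{u} R)).obj M).mapCocone (colimit.cocone F)
  have hc : IsColimit c := isColimitOfPreserves _ (colimit.isColimit F)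
  suffices hs : IsZero c.pt from hs
  rw [IsZero.iff_id_eq_zero]
  refine hc.hom_ext fun t ↦ ?_
  obtain ⟨s, J, hsJ, hJt, hJ⟩ := h t.unop.unop
  have hst : I ^ (max s t.unop.unop) ≤ J := (Ideal.pow_le_pow_right (le_max_left _ _)).trans hsJ
  let t' : (ℕᵒᵖ)ᵒᵖ := Opposite.op (Opposite.op (max s t.unop.unop))
  let f : t ⟶ t' := Quiver.Hom.op (homOfLE (le_max_right s t.unop.unop)).op
  let g₁ : ModuleCat.of R (R ⧸ I ^ (max s t.unop.unop)) ⟶ ModuleCat.of R (R ⧸ J) :=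
    ModuleCat.ofHom (Submodule.mapQ _ _ LinearMap.id hst)
  let g₂ : ModuleCat.of R (R ⧸ J) ⟶ ModuleCat.of R (R ⧸ I ^ t.unop.unop) :=
    ModuleCat.ofHom (Submodule.mapQ _ _ LinearMap.id hJt)
  have hg : (localCohomology.ringModIdeals (localCohomology.idealPowersDiagram I)).map f.unop =
      g₁ ≫ g₂ := by
    refine ModuleCat.hom_ext (LinearMap.ext fun x ↦ ?_)
    obtain ⟨x, rfl⟩ := Ideal.Quotient.mk_surjective x
    rfl
  have hf : (F.map f).app M = 0 := by
    have h1 : F.map f = (Ext R (ModuleCat.{u} R) j).map g₂.op ≫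
        (Ext R (ModuleCat.{u} R) j).map g₁.op := by
      rw [← Functor.map_comp, ← op_comp, ← hg]
      rfl
    rw [h1, NatTrans.comp_app]
    exact (hJ.eq_zero_of_tgt (((Ext R (ModuleCat.{u} R) j).map g₂.op).app M)).symm ▸ zero_comp
  have hι : c.ι.app t = 0 := by
    rw [← c.w f]
    exact (congrArg (fun g ↦ g ≫ c.ι.app t') hf).trans zero_comp
  rw [hι, zero_comp, zero_comp]

lemma isZero_extMod_of_isZero (n : ℕ) (A : ModuleCat.{u} R) {B : ModuleCat.{u} R}
    (hB : IsZero B) : IsZero (extMod R n A B) := by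
  obtain ⟨e⟩ := nonempty_extMod_equiv n A B
  rw [ModuleCat.isZero_iff_subsingleton, e.toEquiv.subsingleton_congr]
  refine subsingleton_of_forall_eq 0 fun α ↦ ?_
  rw [← α.comp_mk₀_id, hB.eq_of_src (𝟙 B) 0, Abelian.Ext.mk₀_zero, Abelian.Ext.comp_zero]

lemma smul_ext_eq_zero {r : R} {X Y : ModuleCat.{u} R} (hr : ∀ x : X, r • x = 0) {n : ℕ}
    (α : Abelian.Ext.{u} X Y n) : r • α = 0 := by
  have h : r • 𝟙 X = 0 := by ext x; exact hr x
  have h1 : r • α = (Abelian.Ext.mk₀ (r • 𝟙 X)).comp α (zero_add _) := by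
    simp [Abelian.Ext.mk₀_smul]
  rw [h1, h, Abelian.Ext.mk₀_zero, Abelian.Ext.zero_comp]

open RingTheory.Sequence in
/-- `Ext` vanishes below the length of a weakly regular sequence annihilating the source. -/
lemma subsingleton_ext_of_isWeaklyRegular {N : ModuleCat.{u} R} (rs : List R)
    (hN : ∀ r ∈ rs, ∀ x : N, r • x = 0) (M : ModuleCat.{u} R) (hM : IsWeaklyRegular M rs)
    (j : ℕ) (hj : j < rs.length) : Subsingleton (Abelian.Ext.{u} N M j) := by
  induction rs generalizing M j with
  | nil => simp at hj
  | cons x rs ih =>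
    rw [isWeaklyRegular_cons_iff] at hM
    simp only [List.mem_cons, forall_eq_or_imp] at hN
    have hS := hM.1.smulShortComplex_shortExact
    cases j with
    | zero =>
      have : Subsingleton (N →ₗ[R] M) := IsSMulRegular.linearMap_subsingleton_of_mem_annihilator
        hM.1 (Module.mem_annihilator.mpr hN.1)
      exact ((Abelian.Ext.linearEquiv₀ (R := R)).toEquiv.trans
        ModuleCat.homEquiv).subsingleton_congr.mpr this
    | succ j =>
      refine subsingleton_of_forall_eq 0 fun α ↦ ?_
      obtain ⟨β, rfl⟩ := Abelian.Ext.covariant_sequence_exact₁ N hS α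
        ((Abelian.Ext.smul_eq_comp_mk₀ α x).symm.trans (smul_ext_eq_zero hN.1 α)) rfl
      have : Subsingleton (Abelian.Ext.{u} N (M.smulShortComplex x).X₃ j) :=
        ih hN.2 (ModuleCat.of R (QuotSMulTop x M)) hM.2 j (by simpa using hj)
      obtain rfl : β = 0 := Subsingleton.elim _ _
      exact Abelian.Ext.zero_comp ..

open RingTheory.Sequence in
/-- Long regular sequences exist inside any power of the maximal ideal when `Ext` from the
residue field vanishes. -/
lemma exists_isWeaklyRegular [IsLocalRing R] [IsNoetherianRing R] (t n : ℕ) (M : ModuleCat.{u} R)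
    [Module.Finite R M] (hM : ∀ i < n, Subsingleton
      (Abelian.Ext.{u} (ModuleCat.of R (R ⧸ IsLocalRing.maximalIdeal R)) M i)) :
    ∃ rs : List R, rs.length = n ∧ IsWeaklyRegular M rs ∧
      ∀ r ∈ rs, r ∈ IsLocalRing.maximalIdeal R ^ t := by
  induction n generalizing M with
  | zero => exact ⟨[], rfl, .nil _ _, by simp⟩
  | succ n ih =>
    have h0 : Subsingleton ((R ⧸ IsLocalRing.maximalIdeal R) →ₗ[R] M) :=
      ((Abelian.Ext.linearEquiv₀ (R := R)).toEquiv.trans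
        ModuleCat.homEquiv).subsingleton_congr.mp (hM 0 n.succ_pos)
    obtain ⟨r, hr, hreg⟩ := IsSMulRegular.subsingleton_linearMap_iff.mp h0
    rw [Ideal.annihilator_quotient] at hr
    have hS := (hreg.pow t).smulShortComplex_shortExact
    obtain ⟨rs, hlen, hrs, hmem⟩ := ih (ModuleCat.of R (QuotSMulTop (r ^ t) M)) fun i hi ↦ by
      refine subsingleton_of_forall_eq 0 fun α ↦ ?_
      have : Subsingleton (Abelian.Ext.{u} (ModuleCat.of R (R ⧸ IsLocalRing.maximalIdeal R))
          (M.smulShortComplex (r ^ t)).X₁ (i + 1)) := hM (i + 1) (by lia)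
      obtain ⟨β, rfl⟩ := Abelian.Ext.covariant_sequence_exact₃ _ hS α rfl (Subsingleton.elim _ _)
      have : Subsingleton (Abelian.Ext.{u} (ModuleCat.of R (R ⧸ IsLocalRing.maximalIdeal R))
          (M.smulShortComplex (r ^ t)).X₂ i) := hM i (by lia)
      obtain rfl : β = 0 := Subsingleton.elim _ _
      exact Abelian.Ext.zero_comp ..
    refine ⟨r ^ t :: rs, by simp [hlen], (isWeaklyRegular_cons_iff _ _ _).mpr ⟨hreg.pow t, hrs⟩, ?_⟩
    simpa using ⟨Ideal.pow_mem_pow hr t, hmem⟩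

open RingTheory.Sequence in
/-- `Ext` vanishes above the length of a regular sequence generating the relations of the source. -/
lemma subsingleton_ext_quotient_ofList_of_length_lt [IsLocalRing R] [IsNoetherianRing R]
    (rs : List R) (hrs : IsWeaklyRegular R rs)
    (hmem : ∀ r ∈ rs, r ∈ IsLocalRing.maximalIdeal R) (M : ModuleCat.{u} R) (j : ℕ)
    (hj : rs.length < j) :
    Subsingleton (Abelian.Ext.{u} (ModuleCat.of R (R ⧸ Ideal.ofList rs)) M j) := by
  have hpd := ModuleCat.projectiveDimension_quotient_eq_add_length_of_isWeaklyRegular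
    (ModuleCat.of R R) rs hrs hmem
  have : Projective (ModuleCat.of R R) :=
    ModuleCat.projective_of_free (Module.Basis.singleton Unit R)
  rw [ModuleCat.projectiveDimension_eq_zero_of_projective (ModuleCat.of R R), zero_add] at hpd
  have hI : Ideal.ofList rs • (⊤ : Submodule R R) = Ideal.ofList rs := by simp
  have e : ModuleCat.of R (R ⧸ Ideal.ofList rs • (⊤ : Submodule R R)) ≅
      ModuleCat.of R (R ⧸ Ideal.ofList rs) := (Submodule.quotEquivOfEq _ _ hI).toModuleIso
  have hle := (projectiveDimension_le_iff _ _).mp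
    ((projectiveDimension_eq_of_iso e).symm.trans hpd).le
  exact hle.subsingleton _ _ _ hj _

open RingTheory.Sequence in
/-- A weakly regular sequence of maximal length generates an ideal containing a power of the
maximal ideal. -/
lemma exists_pow_le_ofList [IsLocalRing R] [IsNoetherianRing R]
    (rs : List R) (hrs : IsWeaklyRegular R rs)
    (hmem : ∀ r ∈ rs, r ∈ IsLocalRing.maximalIdeal R) (hdim : ringKrullDim R = rs.length) :
    ∃ s, IsLocalRing.maximalIdeal R ^ s ≤ Ideal.ofList rs := by
  have hreg := (IsLocalRing.isRegular_iff_isWeaklyRegular_of_subset_maximalIdeal hmem).mpr hrs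
  have h := ringKrullDim_add_length_eq_ringKrullDim_of_isRegular rs hreg
  have h0 : Ring.KrullDimLE 0 (R ⧸ Ideal.ofList rs) := by
    rw [Ring.krullDimLE_iff]
    exact (ENat.WithBot.add_natCast_cancel.mp (h.trans (hdim.trans (zero_add _).symm))).le
  refine Ideal.exists_pow_le_of_le_radical_of_fg ?_ (IsNoetherian.noetherian _)
  rw [Ideal.radical_eq_sInf]
  refine le_sInf fun p ⟨hp, hprime⟩ ↦ ?_
  have := Ring.krullDimLE_zero_iff.mp h0 (p.map (Ideal.Quotient.mk _))
    (Ideal.map_isPrime_of_surjective Ideal.Quotient.mk_surjective (by simpa using hp))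
  have hmax := Ideal.comap_isMaximal_of_surjective _
    (Ideal.Quotient.mk_surjective (I := Ideal.ofList rs)) (K := p.map (Ideal.Quotient.mk _))
  rw [Ideal.comap_map_of_surjective _ Ideal.Quotient.mk_surjective, ← RingHom.ker_eq_comap_bot,
    Ideal.mk_ker, sup_eq_left.mpr hp] at hmax
  exact (IsLocalRing.eq_maximalIdeal hmax).ge

/-- The local cohomology of a Cohen-Macaulay local ring is concentrated in degree its dimension. -/
lemma isZero_localCohomology_of_moduleDepth_eq [IsLocalRing R] [IsNoetherianRing R] (d : ℕ)
    (hdim : ringKrullDim R = d) (hCM : moduleDepth R (ModuleCat.of R R) = d) (j : ℕ)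
    (hj : j ≠ d) :
    IsZero ((localCohomology (IsLocalRing.maximalIdeal R) j).obj (ModuleCat.of R R)) := by
  refine isZero_localCohomology _ _ _ fun t ↦ ?_
  obtain ⟨rs, rfl, hrs, hmem⟩ := exists_isWeaklyRegular (t + 1) d (ModuleCat.of R R) fun i hi ↦ by
    obtain ⟨e⟩ := nonempty_extMod_equiv i
      (ModuleCat.of R (R ⧸ IsLocalRing.maximalIdeal R)) (ModuleCat.of R R)
    rw [← e.toEquiv.subsingleton_congr, ← ModuleCat.isZero_iff_subsingleton]
    exact not_not.mp (Nat.notMem_of_lt_sInf (hi.trans_eq hCM.symm))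
  have hmem' (r) (hr : r ∈ rs) : r ∈ IsLocalRing.maximalIdeal R :=
    Ideal.pow_le_self t.succ_ne_zero (hmem r hr)
  obtain ⟨s, hs⟩ := exists_pow_le_ofList rs hrs hmem' hdim
  refine ⟨s, Ideal.ofList rs, hs,
    (Ideal.span_le.mpr hmem).trans (Ideal.pow_le_pow_right t.le_succ), ?_⟩
  obtain ⟨e⟩ := nonempty_extMod_equiv j (ModuleCat.of R (R ⧸ Ideal.ofList rs)) (ModuleCat.of R R)
  rw [ModuleCat.isZero_iff_subsingleton, e.toEquiv.subsingleton_congr]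
  rcases hj.lt_or_gt with hj | hj
  · refine subsingleton_ext_of_isWeaklyRegular rs (fun r hr x ↦ ?_) _ hrs j hj
    have h : r ∈ Module.annihilator R (R ⧸ Ideal.ofList rs) := by
      rw [Ideal.annihilator_quotient]
      exact Ideal.subset_span hr
    exact Module.mem_annihilator.mp h x
  · exact subsingleton_ext_quotient_ofList_of_length_lt rs hrs hmem' _ j hj

end

end LyubeznikBetti

/-- Let `(R, m, k)` be a complete Cohen-Macaulay Noetherian local ring of
dimension `d` with canonical module `ω_R` (characterized by local duality
`H^d_m(R) ≅ Hom_R(ω_R, E(k))`). Then the Lyubeznik numbers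
`λ_{i,j}(R) = dim_k Ext^i_R(k, H^j_m(R))` vanish for `j ≠ d`, and
`λ_{i,d}(R) = β_i(ω_R)` (expressed by a linear isomorphism
`Ext^i_R(k, H^d_m(R)) ≃ Tor_i^R(k, ω_R)`). -/
theorem stmt_8 (R : Type u) [CommRing R] [IsNoetherianRing R] [IsLocalRing R]
    [IsAdicComplete (IsLocalRing.maximalIdeal R) R]
    (d : ℕ) (hdim : ringKrullDim R = (d : ℕ))
    (hCM : moduleDepth R (ModuleCat.of R R) = d)
    -- `E` is the injective hull of the residue field `k`
    (E : Type u) [AddCommGroup E] [Module R E] (hE : Module.Injective R E)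
    (ι : (R ⧸ IsLocalRing.maximalIdeal R) →ₗ[R] E) (hι : Function.Injective ι)
    (hess : ∀ N : Submodule R E, N ≠ ⊥ → LinearMap.range ι ⊓ N ≠ ⊥)
    -- `ω` is a canonical module of `R`
    (ω : Type u) [AddCommGroup ω] [Module R ω] [Module.Finite R ω]
    (hω : Nonempty
      (((localCohomology (IsLocalRing.maximalIdeal R) d).obj (ModuleCat.of R R)) ≃ₗ[R]
        (ω →ₗ[R] E))) :
    (∀ i j : ℕ, j ≠ d →
      CategoryTheory.Limits.IsZero
        (extMod R i (ModuleCat.of R (R ⧸ IsLocalRing.maximalIdeal R))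
          ((localCohomology (IsLocalRing.maximalIdeal R) j).obj (ModuleCat.of R R)))) ∧
    (∀ i : ℕ,
      Nonempty
        ((extMod R i (ModuleCat.of R (R ⧸ IsLocalRing.maximalIdeal R))
            ((localCohomology (IsLocalRing.maximalIdeal R) d).obj (ModuleCat.of R R)))
          ≃ₗ[R]
          (torMod R i (ModuleCat.of R (R ⧸ IsLocalRing.maximalIdeal R))
            (ModuleCat.of R ω)))) := by
  refine ⟨fun i j hj ↦ ?_, fun i ↦ ?_⟩
  · exact LyubeznikBetti.isZero_extMod_of_isZero _ _
      (LyubeznikBetti.isZero_localCohomology_of_moduleDepth_eq d hdim hCM j hj)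
  · obtain ⟨h⟩ := hω
    exact LyubeznikBetti.nonempty_extMod_dual_equiv_torMod hE ι hι hess ω _ h i
end
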